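/- Let E be a measure space, ĝ ∈ L²(E), and let 𝔽̃ = {v ∈ L²(E) : v ≤ 0 a.e.} with ĝ ∈ 𝔽̃. Let 𝔸 = {x ∈ E : ĝ(x) = 0}. Then the L²-closure of the conical hull cone(𝔽̃ - ĝ) equals {ω ∈ L²(E) : ω ≤ 0 a.e. on 𝔸}. -/

import Mathlib

open MeasureTheory

theorem stmt_12 {α : Type*} [MeasurableSpace α] (μ : Measure α)
    (gb : Lp ℝ 2 μ) (hgb : ∀ᵐ x ∂μ, (gb : α → ℝ) x ≤ 0) :
    closure {w : Lp ℝ 2 μ | ∃ (c : ℝ) (v : Lp ℝ 2 μ),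
        0 ≤ c ∧ (∀ᵐ x ∂μ, (v : α → ℝ) x ≤ 0) ∧ w = c • (v - gb)} =
      {ω : Lp ℝ 2 μ | ∀ᵐ x ∂μ, (gb : α → ℝ) x = 0 → (ω : α → ℝ) x ≤ 0} := by
  apply Set.Subset.antisymm
  · intro ω hω
    obtain ⟨w, hw, hlim⟩ := mem_closure_iff_seq_limit.1 hω
    obtain ⟨φ, -, hφ⟩ := (tendstoInMeasure_of_tendsto_Lp hlim).exists_seq_tendsto_ae
    have hw' : ∀ n, ∀ᵐ x ∂μ, (gb : α → ℝ) x = 0 → (w n : α → ℝ) x ≤ 0 := by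
      intro n
      obtain ⟨c, v, hc, hv, hwn⟩ := hw n
      rw [hwn]
      filter_upwards [hv, Lp.coeFn_smul c (v - gb), Lp.coeFn_sub v gb] with x h1 h2 h3 h4
      rw [h2, Pi.smul_apply, h3, Pi.sub_apply, h4, smul_eq_mul, sub_zero]
      exact mul_nonpos_of_nonneg_of_nonpos hc h1
    filter_upwards [ae_all_iff.2 hw', hφ] with x h1 h2 h3
    exact le_of_tendsto' h2 fun i => h1 _ h3
  · intro ω hω
    let w : ℕ → Lp ℝ 2 μ := fun n => ω ⊓ (-((n : ℝ) + 1) • gb)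
    have hwx : ∀ n, ∀ᵐ x ∂μ, (w n : α → ℝ) x = min ((ω : α → ℝ) x) (-((n : ℝ) + 1) * gb x) := by
      intro n
      filter_upwards [Lp.coeFn_inf ω (-((n : ℝ) + 1) • gb),
        Lp.coeFn_smul (-((n : ℝ) + 1)) gb] with x h1 h2
      rw [h1, Pi.inf_apply, h2]
      rfl
    have hdx : ∀ n, ∀ᵐ x ∂μ, ((w n - ω : Lp ℝ 2 μ) : α → ℝ) x
        = min ((ω : α → ℝ) x) (-((n : ℝ) + 1) * gb x) - ω x := by
      intro n
      filter_upwards [hwx n, Lp.coeFn_sub (w n) ω] with x h1 h2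
      rw [h2, Pi.sub_apply, h1]
    have hlim : Filter.Tendsto w Filter.atTop (nhds ω) := by
      rw [tendsto_iff_norm_sub_tendsto_zero]
      have hsq : Filter.Tendsto (fun n => ‖w n - ω‖ ^ 2) Filter.atTop (nhds 0) := by
        have heq : ∀ n, ‖w n - ω‖ ^ 2
            = ∫ x, inner ℝ ((w n - ω : Lp ℝ 2 μ) x) ((w n - ω : Lp ℝ 2 μ) x) ∂μ := by
          intro n
          rw [← real_inner_self_eq_norm_sq, L2.inner_def]
        simp_rw [heq]
        have h0 : (0 : ℝ) = ∫ x, (0 : ℝ) ∂μ := by simp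
        rw [h0]
        refine tendsto_integral_of_dominated_convergence
          (fun x => inner ℝ (ω x) (ω x)) ?_ (L2.integrable_inner ω ω) ?_ ?_
        · intro n
          exact (L2.integrable_inner (𝕜 := ℝ) (w n - ω) (w n - ω)).aestronglyMeasurable
        · intro n
          filter_upwards [hdx n, hgb] with x h1 h2
          rw [h1, real_inner_self_eq_norm_sq, real_inner_self_eq_norm_sq, norm_pow, norm_norm]
          gcongr
          simp only [Real.norm_eq_abs]
          have h3 : 0 ≤ -((n : ℝ) + 1) * gb x := by
            have : (0 : ℝ) ≤ n := n.cast_nonneg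
            nlinarith
          rcases min_cases ((ω : α → ℝ) x) (-((n : ℝ) + 1) * gb x) with ⟨h, h'⟩ | ⟨h, h'⟩
          · rw [h]; simp
          · rw [h, abs_sub_comm, abs_of_nonneg (by linarith)]
            exact le_trans (by linarith) (le_abs_self _)
        · filter_upwards [ae_all_iff.2 hdx, hgb, hω] with x h1 h2 h3
          apply tendsto_const_nhds.congr'
          have hev : ∀ᶠ n : ℕ in Filter.atTop, (ω : α → ℝ) x ≤ -((n : ℝ) + 1) * gb x := by
            rcases h2.lt_or_eq with h | h
            · obtain ⟨N, hN⟩ := exists_nat_gt ((ω : α → ℝ) x / (-gb x))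
              filter_upwards [Filter.eventually_ge_atTop N] with n hn
              have hn' : (N : ℝ) ≤ n := by exact_mod_cast hn
              rw [div_lt_iff₀ (by linarith)] at hN
              nlinarith
            · filter_upwards with n
              rw [h, mul_zero]
              exact h3 h
          filter_upwards [hev] with n hn
          rw [h1 n, min_eq_left hn]
          simp
      have := hsq.sqrt
      simpa using this
    refine mem_closure_of_tendsto hlim (Filter.Eventually.of_forall fun n => ?_)
    have hn : (0 : ℝ) < (n : ℝ) + 1 := by positivity
    refine ⟨(n : ℝ) + 1, ((n : ℝ) + 1)⁻¹ • w n + gb, hn.le, ?_, ?_⟩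
    · filter_upwards [hwx n, Lp.coeFn_add (((n : ℝ) + 1)⁻¹ • w n) gb,
        Lp.coeFn_smul ((n : ℝ) + 1)⁻¹ (w n)] with x h1 h2 h3
      rw [h2, Pi.add_apply, h3, Pi.smul_apply, h1, smul_eq_mul]
      have h4 := mul_le_mul_of_nonneg_left
        (min_le_right ((ω : α → ℝ) x) (-((n : ℝ) + 1) * gb x)) (inv_pos.2 hn).le
      have h5 : ((n : ℝ) + 1)⁻¹ * (-((n : ℝ) + 1) * gb x) = - gb x := by
        field_simp
      linarith
    · rw [add_sub_cancel_right, smul_smul, mul_inv_cancel₀ hn.ne', one_smul]
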